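/- Let W be the Coxeter group of type E₆ and let J₆ = {1,2,3,4,5} (all Bourbaki nodes except node 6). Consider the natural left action of the standard parabolic subgroup W_{J₆} on the 27-element coset space W/W_{J₆}. This action has exactly 3 orbits, of cardinalities 1, 10 and 16. (The three orbits correspond to the three strata of the Chernousov–Merkurjev filtration of G/P₆ × G/P₆ for a group G of inner type E₆, i.e. to the three mutual positions of two 'lines' in the geometry of the symmetric space EIII.) -/

import Mathlib

/-- The Coxeter group of type E₆, presented by the Coxeter matrix `CoxeterMatrix.E₆`.
With `Fin 6` indexing, index `i` corresponds to Bourbaki node `i + 1`: the entries equal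
to `3` are exactly at the pairs `(0,2), (2,3), (3,4), (4,5), (1,3)`, i.e. nodes
`1,3,4,5,6` form a chain and node `2` is attached to node `4`. -/
abbrev E6Group : Type := CoxeterMatrix.E₆.Group

/-- The standard parabolic subgroup `W_J` of the Coxeter group of type E₆, generated by the
simple reflections `sᵢ` for `i ∈ J` (indices `0,…,5` correspond to Bourbaki nodes `1,…,6`). -/
def E6Parabolic (J : Set (Fin 6)) : Subgroup E6Group :=
  Subgroup.closure (CoxeterMatrix.E₆.simple '' J)

/-- `J₆` = all Bourbaki nodes except node 6, i.e. indices `{0,1,2,3,4}`. -/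
def J₆ : Set (Fin 6) := {0, 1, 2, 3, 4}

namespace E6Coset

open CoxeterMatrix MulAction

/-- The action of the simple reflections on the 27 weights of the minuscule representation of
type E₆ with highest weight `ω₆`; weights are numbered downwards from the highest weight `0`. -/
def reflect : Fin 6 → Fin 27 → Fin 27 := ![
  ![0, 1, 2, 3, 4, 7, 8, 5, 6, 10, 9, 13, 12, 11,
    16, 15, 14, 17, 18, 19, 20, 21, 22, 23, 24, 26, 25],
  ![0, 1, 2, 4, 3, 6, 5, 8, 7, 9, 10, 11, 12, 13,
    14, 15, 16, 19, 18, 17, 21, 20, 23, 22, 24, 25, 26],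
  ![0, 1, 2, 5, 6, 3, 4, 7, 8, 9, 12, 11, 10, 15,
    14, 13, 18, 17, 16, 19, 20, 21, 22, 23, 25, 24, 26],
  ![0, 1, 3, 2, 4, 5, 9, 7, 10, 6, 8, 11, 12, 13,
    14, 17, 16, 15, 20, 19, 18, 21, 22, 24, 23, 25, 26],
  ![0, 2, 1, 3, 4, 5, 6, 7, 8, 11, 13, 9, 15, 10,
    14, 12, 16, 17, 18, 19, 22, 23, 20, 21, 24, 25, 26],
  ![1, 0, 2, 3, 4, 5, 6, 7, 8, 9, 10, 14, 12, 16,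
    11, 18, 13, 20, 15, 21, 17, 19, 22, 23, 24, 25, 26]]

/-- For each weight other than the highest one, the index of a simple reflection raising it. -/
def ascent : Fin 27 → Fin 6 :=
  ![0, 5, 4, 3, 1, 2, 1, 0, 0, 3, 0, 4, 2, 0, 5, 2, 0, 3, 2, 1, 3, 1, 4, 1, 3, 2, 0]

/-- The highest weight in the orbit of a given weight under the reflections indexed by `J₆`. -/
def orbitTop (x : Fin 27) : Fin 27 :=
  if x = 0 then 0 else if x ∈ ({14, 16, 18, 20, 21, 22, 23, 24, 25, 26} : Finset _) then 14 else 1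

theorem reflect_involutive (i : Fin 6) : Function.Involutive (reflect i) := by
  revert i; unfold Function.Involutive; decide

theorem reflect_ascent_lt : ∀ x, x ≠ 0 → reflect (ascent x) x < x := by decide

/-- A simple reflection that does not lower `x` is either `ascent x` itself, or commutes with it,
or is linked to it by a braid relation on a three-element orbit with lowest element `x`. -/
theorem reflect_le_cases : ∀ x i, x ≠ 0 → reflect i x ≤ x →
    i = ascent x ∨
    (E₆ i (ascent x) = 2 ∧ reflect i (reflect (ascent x) x) ≤ reflect (ascent x) x ∧
      (reflect i x = x ∧ reflect i (reflect (ascent x) x) = reflect (ascent x) x ∨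
       reflect i x < x ∧ reflect (ascent x) (reflect i x) ≤ reflect i x ∧
         reflect i (reflect (ascent x) x) = reflect (ascent x) (reflect i x))) ∨
    (E₆ i (ascent x) = 3 ∧ reflect i x = x ∧
      reflect i (reflect (ascent x) x) < reflect (ascent x) x ∧
      reflect (ascent x) (reflect i (reflect (ascent x) x)) = reflect i (reflect (ascent x) x)) := by
  decide

/-- The simple reflections as permutations of the weights. -/
def reflectPerm (i : Fin 6) : Equiv.Perm (Fin 27) := (reflect_involutive i).toPerm

theorem reflectPerm_apply (i : Fin 6) (x : Fin 27) : reflectPerm i x = reflect i x := rfl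

theorem isLiftable_reflectPerm : E₆.IsLiftable reflectPerm := by
  have h : ∀ i j x, (fun y => reflect i (reflect j y))^[E₆ i j] x = x := by decide
  intro i j
  ext1 x
  rw [← Equiv.Perm.iterate_eq_pow]
  exact h i j x

/-- The permutation representation of the Coxeter group of type E₆ on the 27 weights. -/
def weightRep : E6Group →* Equiv.Perm (Fin 27) :=
  E₆.toCoxeterSystem.lift ⟨reflectPerm, isLiftable_reflectPerm⟩

theorem weightRep_simple (i : Fin 6) : weightRep (E₆.simple i) = reflectPerm i :=
  E₆.toCoxeterSystem.lift_apply_simple isLiftable_reflectPerm i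

theorem weightRep_zero_of_mem {w : E6Group} (hw : w ∈ E6Parabolic J₆) : weightRep w 0 = 0 := by
  have h : E6Parabolic J₆ ≤ (stabilizer (Equiv.Perm (Fin 27)) (0 : Fin 27)).comap weightRep := by
    refine (Subgroup.closure_le _).2 ?_
    rintro _ ⟨i, hi, rfl⟩
    rw [SetLike.mem_coe, Subgroup.mem_comap, mem_stabilizer_iff, weightRep_simple]
    change reflect i 0 = 0
    simp only [J₆, Set.mem_insert_iff, Set.mem_singleton_iff] at hi
    revert i; decide
  exact h hw

/-- The weight of a coset `wW_{J₆}`: the image of the highest weight under `w`. -/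
def weight : E6Group ⧸ E6Parabolic J₆ → Fin 27 :=
  Quotient.lift (fun w => weightRep w 0) fun a b hab => by
    have h := weightRep_zero_of_mem (QuotientGroup.leftRel_apply.1 hab)
    rw [map_mul, map_inv, Equiv.Perm.mul_apply, Equiv.Perm.inv_eq_iff_eq] at h
    exact h.symm

theorem weight_smul (w : E6Group) (q : E6Group ⧸ E6Parabolic J₆) :
    weight (w • q) = weightRep w (weight q) := by
  induction q using QuotientGroup.induction_on with
  | H g => exact congrArg (· 0) (map_mul weightRep w g)

/-- The coset of a given weight, reached by following `ascent` to the highest weight. -/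
def coset (x : Fin 27) : E6Group ⧸ E6Parabolic J₆ :=
  if _h : x = 0 then ((1 : E6Group) : E6Group ⧸ E6Parabolic J₆)
  else E₆.simple (ascent x) • coset (reflect (ascent x) x)
termination_by x
decreasing_by exact reflect_ascent_lt x _h

theorem coset_zero : coset 0 = ((1 : E6Group) : E6Group ⧸ E6Parabolic J₆) := by
  rw [coset, dif_pos rfl]

theorem coset_of_ne_zero {x : Fin 27} (h : x ≠ 0) :
    coset x = E₆.simple (ascent x) • coset (reflect (ascent x) x) := by
  rw [coset, dif_neg h]

theorem weight_coset (x : Fin 27) : weight (coset x) = x := by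
  induction x using WellFoundedLT.induction with
  | ind x ih =>
    by_cases h : x = 0
    · subst h
      rw [coset_zero]
      exact congrArg (· 0) (map_one weightRep)
    · rw [coset_of_ne_zero h, weight_smul, ih _ (reflect_ascent_lt x h), weightRep_simple,
        reflectPerm_apply, reflect_involutive]

theorem simple_smul_smul_self {X : Type*} [MulAction E6Group X] (i : Fin 6) (q : X) :
    E₆.simple i • E₆.simple i • q = q := by
  rw [smul_smul, ← toCoxeterSystem_simple, CoxeterSystem.simple_mul_simple_self, one_smul]

theorem simple_smul_comm {X : Type*} [MulAction E6Group X] {i j : Fin 6} (h : E₆ i j = 2) (q : X) :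
    E₆.simple i • E₆.simple j • q = E₆.simple j • E₆.simple i • q := by
  have hb := E₆.toCoxeterSystem.simple_mul_simple_pow i j
  rw [h, toCoxeterSystem_simple, pow_two, mul_eq_one_iff_eq_inv, mul_inv_rev,
    ← toCoxeterSystem_simple, CoxeterSystem.inv_simple, CoxeterSystem.inv_simple,
    toCoxeterSystem_simple] at hb
  rw [smul_smul, hb, mul_smul]

theorem simple_smul_braid {X : Type*} [MulAction E6Group X] {i j : Fin 6} (h : E₆ i j = 3) (q : X) :
    E₆.simple i • E₆.simple j • E₆.simple i • q = E₆.simple j • E₆.simple i • E₆.simple j • q := by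
  have hb : ((E₆.simple i * E₆.simple j) ^ 3) • (E₆.simple j • E₆.simple i • E₆.simple j • q) =
      E₆.simple j • E₆.simple i • E₆.simple j • q := by
    rw [← h, ← toCoxeterSystem_simple, CoxeterSystem.simple_mul_simple_pow, one_smul]
  simpa only [pow_succ, pow_zero, one_mul, mul_smul, simple_smul_smul_self] using hb

theorem simple_smul_coset_of_le (x : Fin 27) :
    ∀ i, reflect i x ≤ x → E₆.simple i • coset x = coset (reflect i x) := by
  induction x using WellFoundedLT.induction with
  | ind x ih =>
    intro i hi
    by_cases hx : x = 0
    · subst hx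
      have h0 : ∀ i, reflect i 0 ≤ 0 → reflect i 0 = 0 ∧ i ∈ ({0, 1, 2, 3, 4} : Finset _) := by
        decide
      obtain ⟨hi, hJ⟩ := h0 i hi
      rw [hi, coset_zero]
      refine QuotientGroup.eq.2 ?_
      change (E₆.simple i * 1)⁻¹ * 1 ∈ E6Parabolic J₆
      rw [mul_one, mul_one, inv_mem_iff]
      exact Subgroup.subset_closure ⟨i, by simpa [J₆] using hJ, rfl⟩
    · have hlt := reflect_ascent_lt x hx
      rw [coset_of_ne_zero hx]
      rcases reflect_le_cases x i hx hi with rfl | ⟨hm, hle, h⟩ | ⟨hm, hfix, hlt', hfix'⟩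
      · rw [simple_smul_smul_self]
      · rw [simple_smul_comm hm, ih _ hlt i hle]
        rcases h with ⟨hxi, hu⟩ | ⟨hxi, hle', hu⟩
        · rw [hu, hxi, ← coset_of_ne_zero hx]
        · rw [hu, ← ih _ hxi _ hle', simple_smul_smul_self]
      · set u := reflect (ascent x) x
        have hv : E₆.simple i • coset (reflect i u) = coset u := by
          rw [← ih u hlt i hlt'.le, simple_smul_smul_self]
        have hk := ih _ (hlt'.trans hlt) (ascent x) hfix'.le
        rw [hfix'] at hk
        rw [← hv, simple_smul_braid hm, hk, hv, hfix]
        exact (coset_of_ne_zero hx).symm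

theorem simple_smul_coset (i : Fin 6) (x : Fin 27) :
    E₆.simple i • coset x = coset (reflect i x) := by
  rcases le_total (reflect i x) x with h | h
  · exact simple_smul_coset_of_le x i h
  · have h' := simple_smul_coset_of_le (reflect i x) i (by rwa [reflect_involutive])
    rw [reflect_involutive] at h'
    rw [← h', simple_smul_smul_self]

theorem smul_coset (w : E6Group) (x : Fin 27) : w • coset x = coset (weightRep w x) := by
  induction w using E₆.toCoxeterSystem.simple_induction_left with
  | one => simp
  | mul_simple_left w i ih =>
    rw [toCoxeterSystem_simple, mul_smul, ih, simple_smul_coset, map_mul, weightRep_simple]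
    rfl

/-- The 27 weights parametrize the cosets of `W_{J₆}`. -/
def cosetEquiv : Fin 27 ≃ E6Group ⧸ E6Parabolic J₆ where
  toFun := coset
  invFun := weight
  left_inv := weight_coset
  right_inv q := by
    induction q using QuotientGroup.induction_on with
    | H g =>
      change coset (weightRep g 0) = _
      rw [← smul_coset, coset_zero]
      exact congrArg _ (mul_one g)

theorem orbitTop_weightRep {w : E6Group} (hw : w ∈ E6Parabolic J₆) (x : Fin 27) :
    orbitTop (weightRep w x) = orbitTop x := by
  have h : ∀ i ∈ ({0, 1, 2, 3, 4} : Finset _), ∀ x, orbitTop (reflect i x) = orbitTop x := by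
    decide
  induction hw using Subgroup.closure_induction generalizing x with
  | mem w hw =>
    obtain ⟨i, hi, rfl⟩ := hw
    rw [weightRep_simple]
    exact h i (by simpa [J₆] using hi) x
  | one => simp
  | mul a b _ _ ha hb => rw [map_mul, Equiv.Perm.mul_apply, ha, hb]
  | inv a _ ha => rw [← ha, ← Equiv.Perm.mul_apply, ← map_mul, mul_inv_cancel, map_one]; rfl

theorem coset_mem_orbit_coset_orbitTop (x : Fin 27) :
    coset x ∈ orbit (E6Parabolic J₆) (coset (orbitTop x)) := by
  have h : ∀ x, x = orbitTop x ∨ ∃ i ∈ ({0, 1, 2, 3, 4} : Finset _),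
      reflect i x < x ∧ orbitTop (reflect i x) = orbitTop x := by
    decide
  induction x using WellFoundedLT.induction with
  | ind x ih =>
    rcases h x with h | ⟨i, hi, hlt, htop⟩
    · rw [← h]
      exact mem_orbit_self _
    · have hs : E₆.simple i ∈ E6Parabolic J₆ :=
        Subgroup.subset_closure ⟨i, by simpa [J₆] using hi, rfl⟩
      have hx : coset x = (⟨E₆.simple i, hs⟩ : E6Parabolic J₆) • coset (reflect i x) := by
        change coset x = E₆.simple i • coset (reflect i x)
        rw [simple_smul_coset, reflect_involutive]
      rw [hx, ← htop]
      exact mem_orbit_of_mem_orbit _ (ih _ hlt)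

theorem coset_mem_orbit_coset_iff {x y : Fin 27} :
    coset x ∈ orbit (E6Parabolic J₆) (coset y) ↔ orbitTop x = orbitTop y := by
  constructor
  · rintro ⟨⟨w, hw⟩, h⟩
    change w • coset y = coset x at h
    rw [smul_coset] at h
    rw [← cosetEquiv.injective h, orbitTop_weightRep hw]
  · intro h
    have hx := coset_mem_orbit_coset_orbitTop x
    rwa [h, orbit_eq_iff.2 (mem_orbit_symm.1 (coset_mem_orbit_coset_orbitTop y))] at hx

theorem card_orbit_coset (y : Fin 27) :
    Nat.card (orbit (E6Parabolic J₆) (coset y)) =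
      (Finset.univ.filter fun x => orbitTop x = orbitTop y).card := by
  rw [← Fintype.card_subtype, ← Nat.card_eq_fintype_card]
  exact (Nat.card_congr (cosetEquiv.subtypeEquiv fun _ => coset_mem_orbit_coset_iff.symm)).symm

end E6Coset


/-- The natural left-multiplication action of the standard parabolic subgroup `W_{J₆}` on the
27-element coset space `W/W_{J₆}` has exactly 3 orbits, of cardinalities 1, 10 and 16
(the three strata of the Chernousov–Merkurjev filtration of `G/P₆ × G/P₆`). -/
theorem orbits_P6_on_W_mod_P6 :
    Nat.card (E6Group ⧸ E6Parabolic J₆) = 27 ∧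
    ∃ o₁ o₂ o₃ :
        MulAction.orbitRel.Quotient (E6Parabolic J₆) (E6Group ⧸ E6Parabolic J₆),
      o₁ ≠ o₂ ∧ o₁ ≠ o₃ ∧ o₂ ≠ o₃ ∧
      (∀ o : MulAction.orbitRel.Quotient (E6Parabolic J₆) (E6Group ⧸ E6Parabolic J₆),
        o = o₁ ∨ o = o₂ ∨ o = o₃) ∧
      Nat.card o₁.orbit = 1 ∧ Nat.card o₂.orbit = 10 ∧ Nat.card o₃.orbit = 16 := by
  open E6Coset in
  refine ⟨by simpa using (Nat.card_congr cosetEquiv).symm,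
    Quotient.mk'' (coset 0), Quotient.mk'' (coset 14), Quotient.mk'' (coset 1), ?_, ?_, ?_, ?_,
    (card_orbit_coset 0).trans (by decide), (card_orbit_coset 14).trans (by decide),
    (card_orbit_coset 1).trans (by decide)⟩
  · exact fun h => absurd (coset_mem_orbit_coset_iff.1 (Quotient.exact h)) (by decide)
  · exact fun h => absurd (coset_mem_orbit_coset_iff.1 (Quotient.exact h)) (by decide)
  · exact fun h => absurd (coset_mem_orbit_coset_iff.1 (Quotient.exact h)) (by decide)
  · intro o
    induction o using Quotient.inductionOn' with
    | h q =>
      obtain ⟨x, rfl⟩ := cosetEquiv.surjective q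
      have h : ∀ x, orbitTop x = orbitTop 0 ∨ orbitTop x = orbitTop 14 ∨
          orbitTop x = orbitTop 1 := by decide
      exact (h x).imp (fun h => Quotient.sound (coset_mem_orbit_coset_iff.2 h))
        (Or.imp (fun h => Quotient.sound (coset_mem_orbit_coset_iff.2 h))
          fun h => Quotient.sound (coset_mem_orbit_coset_iff.2 h))
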